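/- Let A be a complex C*-algebra, E ⊆ A a closed *-subspace, 𝓐 ⊆ A a dense *-subspace with 𝓔 := E ∩ 𝓐 dense in E, and (e_λ)_{λ∈Λ} a norm-defining approximate order unit for 𝓐 contained in 𝓔. Then for every positive bounded linear functional φ on E, the net of real numbers (φ(e_λ))_{λ∈Λ} converges to ‖φ‖; in particular ‖φ‖ = sup_λ φ(e_λ). -/

import Mathlib

open scoped ComplexOrder

/-- If a `2 × 2` matrix with equal diagonal entries `p` and off-diagonal entries `x`, `star x`
is positive, then `2 p + w x + (w x)*` is positive for every unimodular `w`. -/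
lemma nonneg_of_matrix_eq_star_mul_self {A : Type*} [NonUnitalRing A] [StarRing A]
    [Module ℂ A] [StarModule ℂ A] [SMulCommClass ℂ A A] [IsScalarTower ℂ A A]
    [PartialOrder A] [StarOrderedRing A] {p x : A} {z : Matrix (Fin 2) (Fin 2) A}
    (h : !![p, x; star x, p] = star z * z) {w : ℂ} (hw : star w * w = 1) :
    0 ≤ p + p + (w • x + star (w • x)) := by
  have h00 := congrFun (congrFun h 0) 0
  have h01 := congrFun (congrFun h 0) 1
  have h11 := congrFun (congrFun h 1) 1
  simp only [Matrix.of_apply, Matrix.cons_val', Matrix.cons_val_zero, Matrix.cons_val_one,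
    Matrix.cons_val_fin_one, Matrix.mul_apply, Fin.sum_univ_two, Matrix.star_apply]
    at h00 h01 h11
  have key : p + p + (w • x + star (w • x)) =
      star (z 0 0 + w • z 0 1) * (z 0 0 + w • z 0 1)
        + star (z 1 0 + w • z 1 1) * (z 1 0 + w • z 1 1) := by
    have hp : p + p = (star (z 0 0) * z 0 0 + star (z 1 0) * z 1 0)
        + (star (z 0 1) * z 0 1 + star (z 1 1) * z 1 1) := by rw [← h00, ← h11]
    rw [hp, h01]
    simp only [star_add, star_smul, star_mul, star_star, add_mul, mul_add, smul_mul_assoc,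
      mul_smul_comm, smul_add, smul_smul, mul_comm w (star w), hw, one_smul]
    abel
  rw [key]
  exact add_nonneg (star_mul_self_nonneg _) (star_mul_self_nonneg _)

/-- A positive element `a` of a C*-algebra gives a positive matrix with all entries `a`. -/
lemma exists_matrix_eq_star_mul_self_of_nonneg {A : Type*} [NonUnitalCStarAlgebra A]
    [PartialOrder A] [StarOrderedRing A] {a : A} (ha : 0 ≤ a) :
    ∃ z : Matrix (Fin 2) (Fin 2) A, !![a, a; a, a] = star z * z := by
  obtain ⟨s, rfl⟩ := CStarAlgebra.nonneg_iff_eq_star_mul_self.mp ha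
  refine ⟨!![s, s; 0, 0], ?_⟩
  ext i j
  fin_cases i <;> fin_cases j <;> simp [Matrix.mul_apply, Fin.sum_univ_two, Matrix.star_apply]

/-- A complex number can be rotated onto the negative real axis. -/
lemma exists_star_mul_self_eq_one_and_mul_eq_neg_norm (c : ℂ) :
    ∃ w : ℂ, star w * w = 1 ∧ w * c = -(‖c‖ : ℂ) := by
  rcases eq_or_ne c 0 with rfl | hc
  · exact ⟨1, by simp, by simp⟩
  · have hn : (‖c‖ : ℂ) ≠ 0 := by simpa using hc
    have hcc : star c * c = (‖c‖ : ℂ) ^ 2 := Complex.conj_mul' c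
    refine ⟨-(star c / ‖c‖), ?_, ?_⟩
    · simp only [star_neg, star_div₀, Complex.star_def, Complex.conj_ofReal,
        Complex.conj_conj]
      rw [Complex.star_def] at hcc
      field_simp
      linear_combination hcc
    · field_simp
      linear_combination -hcc

/-- Let `E` be a closed *-subspace of a C*-algebra `A`, `𝓐` a dense *-subspace
with `𝓔 := E ⊓ 𝓐` dense in `E`, and `(e l)` a norm-defining approximate order unit for `𝓐`
contained in `𝓔` (positivity of a 2×2 matrix over `A` meaning it is of the form `z* z`).
Then for every positive bounded functional `φ` on `E`, the net `φ (e l)` converges to `‖φ‖`;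
in particular `‖φ‖ = ⨆ l, (φ (e l)).re`. -/
theorem stmt11 {A : Type*} [NonUnitalNormedRing A] [StarRing A] [CStarRing A]
    [NormedSpace ℂ A] [StarModule ℂ A] [SMulCommClass ℂ A A] [IsScalarTower ℂ A A]
    [CompleteSpace A] [PartialOrder A] [StarOrderedRing A]
    (E : Submodule ℂ A) (hEclosed : IsClosed (E : Set A)) (hEstar : ∀ x ∈ E, star x ∈ E)
    (𝓐 : Submodule ℂ A) (h𝓐dense : Dense (𝓐 : Set A)) (h𝓐star : ∀ x ∈ 𝓐, star x ∈ 𝓐)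
    (h𝓔dense : (E : Set A) ⊆ closure ((E ⊓ 𝓐 : Submodule ℂ A) : Set A))
    {Λ : Type*} [Nonempty Λ] [Preorder Λ] [IsDirected Λ (· ≤ ·)]
    (e : Λ → A) (heE : ∀ l, e l ∈ E) (he𝓐 : ∀ l, e l ∈ 𝓐)
    (hepos : ∀ l, 0 ≤ e l) (hemono : Monotone e)
    (hnorm : ∀ x ∈ 𝓐, ‖x‖ = sInf {t : ℝ | 0 ≤ t ∧ ∃ l : Λ,
      ∃ z : Matrix (Fin 2) (Fin 2) A,
        !![(t : ℂ) • e l, x; star x, (t : ℂ) • e l] = star z * z})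
    (φ : E →L[ℂ] ℂ) (hφpos : ∀ x : E, 0 ≤ (x : A) → 0 ≤ φ x) :
    Filter.Tendsto (fun l => φ ⟨e l, heE l⟩) Filter.atTop (nhds ((‖φ‖ : ℝ) : ℂ)) ∧
      ‖φ‖ = ⨆ l, (φ ⟨e l, heE l⟩).re := by
  let : NonUnitalCStarAlgebra A := { }
  set f : Λ → ℝ := fun l => (φ ⟨e l, heE l⟩).re
  have hφe : ∀ l, φ ⟨e l, heE l⟩ = (f l : ℂ) := fun l =>
    Complex.eq_re_of_ofReal_le (r := 0) (by simpa using hφpos ⟨e l, heE l⟩ (hepos l))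
  have hf0 : ∀ l, 0 ≤ f l := fun l =>
    (Complex.nonneg_iff.mp (hφpos ⟨e l, heE l⟩ (hepos l))).1
  have hfmono : Monotone f := fun l m hlm => by
    have h := hφpos (⟨e m, heE m⟩ - ⟨e l, heE l⟩) (by simpa using hemono hlm)
    rw [map_sub, hφe, hφe, ← Complex.ofReal_sub, Complex.zero_le_real] at h
    linarith
  have hbdd : ∀ y, BddBelow {t : ℝ | 0 ≤ t ∧ ∃ l : Λ, ∃ z : Matrix (Fin 2) (Fin 2) A,
      !![(t : ℂ) • e l, y; star y, (t : ℂ) • e l] = star z * z} :=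
    fun y => ⟨0, fun t ht => ht.1⟩
  have hele : ∀ l, ‖e l‖ ≤ 1 := fun l => by
    rw [hnorm _ (he𝓐 l)]
    refine csInf_le (hbdd _) ⟨zero_le_one, l, ?_⟩
    obtain ⟨z, hz⟩ := exists_matrix_eq_star_mul_self_of_nonneg (hepos l)
    exact ⟨z, by simpa [(IsSelfAdjoint.of_nonneg (hepos l)).star_eq] using hz⟩
  have hfle : ∀ l, f l ≤ ‖φ‖ := fun l =>
    (Complex.re_le_norm _).trans ((φ.le_opNorm _).trans
      (mul_le_of_le_one_right (norm_nonneg _) (hele l)))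
  have hfbdd : BddAbove (Set.range f) := ⟨‖φ‖, by rintro _ ⟨l, rfl⟩; exact hfle l⟩
  have hdom : ∀ x ∈ 𝓐, ∀ r : ℝ, ‖x‖ < r → ∃ t : ℝ, 0 ≤ t ∧ t < r ∧ ∃ l, ∀ w : ℂ,
      star w * w = 1 → 0 ≤ (t : ℂ) • e l + (t : ℂ) • e l + (w • x + star (w • x)) := by
    intro x hx r hr
    have hne : {t : ℝ | 0 ≤ t ∧ ∃ l : Λ, ∃ z : Matrix (Fin 2) (Fin 2) A,
        !![(t : ℂ) • e l, x; star x, (t : ℂ) • e l] = star z * z}.Nonempty := by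
      by_contra hemp
      have h0 : ‖x‖ = 0 := by
        rw [hnorm x hx, Set.not_nonempty_iff_eq_empty.mp hemp, Real.sInf_empty]
      refine hemp ⟨0, le_rfl, Classical.arbitrary Λ, 0, ?_⟩
      rw [norm_eq_zero.mp h0]
      ext i j
      fin_cases i <;> fin_cases j <;> simp
    rw [hnorm x hx] at hr
    obtain ⟨t, ⟨ht0, l, z, hz⟩, htr⟩ := exists_lt_of_csInf_lt hne hr
    exact ⟨t, ht0, htr, l, fun w hw => nonneg_of_matrix_eq_star_mul_self hz hw⟩
  have himz : ∀ x : E, (x : A) ∈ 𝓐 →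
      (φ (x + ⟨star (x : A), hEstar x x.2⟩)).im = 0 := by
    intro x hx
    obtain ⟨t, -, -, l, h⟩ := hdom x hx (‖(x : A)‖ + 1) (by linarith)
    have h1 := hφpos ((t : ℂ) • ⟨e l, heE l⟩ + (t : ℂ) • ⟨e l, heE l⟩
      + (x + ⟨star (x : A), hEstar x x.2⟩)) (by simpa using h 1 (by simp))
    rw [map_add, map_add, map_smul, hφe] at h1
    simpa using (Complex.nonneg_iff.mp h1).2.symm
  have hφstar : ∀ x : E, (x : A) ∈ 𝓐 →
      φ ⟨star (x : A), hEstar x x.2⟩ = star (φ x) := by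
    intro x hx
    have h1 := himz x hx
    have h2 := himz (Complex.I • x) (𝓐.smul_mem _ hx)
    have h3 : (⟨star ((Complex.I • x : E) : A), hEstar _ (Complex.I • x).2⟩ : E)
        = -(Complex.I • ⟨star (x : A), hEstar x x.2⟩) := by
      ext
      simp
    rw [h3] at h2
    simp only [map_add, map_neg, map_smul, Complex.add_im, Complex.neg_im, smul_eq_mul,
      Complex.I_mul_im] at h1 h2
    apply Complex.ext
    · simp only [Complex.star_def, Complex.conj_re]
      linarith
    · simp only [Complex.star_def, Complex.conj_im]
      linarith
  have hφle : ∀ x : E, (x : A) ∈ 𝓐 → ‖φ x‖ ≤ (⨆ l, f l) * ‖x‖ := by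
    intro x hx
    have hs0 : 0 ≤ ⨆ l, f l := Real.iSup_nonneg hf0
    refine le_of_forall_pos_le_add fun ε hε => ?_
    set s := ⨆ l, f l
    obtain ⟨t, ht0, htr, l, h⟩ := hdom x hx (‖x‖ + ε / (s + 1))
      (lt_add_of_pos_right _ (by positivity))
    obtain ⟨w, hw, hwc⟩ := exists_star_mul_self_eq_one_and_mul_eq_neg_norm (φ x)
    have hwx : ((w • x : E) : A) ∈ 𝓐 := 𝓐.smul_mem _ hx
    have h1 := hφpos ((t : ℂ) • ⟨e l, heE l⟩ + (t : ℂ) • ⟨e l, heE l⟩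
      + (w • x + ⟨star ((w • x : E) : A), hEstar _ (w • x).2⟩)) (by simpa using h w hw)
    rw [map_add, map_add, map_add, map_smul, hφe, hφstar _ hwx, map_smul, smul_eq_mul,
      smul_eq_mul, hwc] at h1
    have h2 : ‖φ x‖ ≤ t * f l := by
      have h3 := (Complex.nonneg_iff.mp h1).1
      simp at h3
      linarith
    have hfs : f l ≤ s := le_ciSup hfbdd l
    calc ‖φ x‖ ≤ t * f l := h2
      _ ≤ (‖x‖ + ε / (s + 1)) * s := by gcongr; exact hf0 l
      _ = s * ‖x‖ + ε * (s / (s + 1)) := by ring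
      _ ≤ s * ‖x‖ + ε := by
        gcongr
        exact mul_le_of_le_one_right hε.le ((div_le_one (by positivity)).mpr (by linarith))
  have hsup : ‖φ‖ = ⨆ l, f l := by
    refine le_antisymm (φ.opNorm_le_bound (Real.iSup_nonneg hf0) fun x => ?_) (ciSup_le hfle)
    have hcl : IsClosed {x : E | ‖φ x‖ ≤ (⨆ l, f l) * ‖x‖} :=
      isClosed_le (by fun_prop) (by fun_prop)
    refine closure_minimal (s := {x : E | (x : A) ∈ 𝓐}) (fun y hy => hφle y hy) hcl ?_
    rw [closure_subtype]
    refine closure_mono ?_ (h𝓔dense x.2)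
    rintro y ⟨hyE, hy𝓐⟩
    exact ⟨⟨y, hyE⟩, hy𝓐, rfl⟩
  refine ⟨?_, hsup⟩
  simp_rw [hφe, hsup]
  exact (Complex.continuous_ofReal.tendsto _).comp (tendsto_atTop_ciSup hfmono hfbdd)
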